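/- arXiv:2108.01168 — 6 statements merged into one kernel-verified Lean document; each statement's English description precedes it below -/
import Mathlib

section
/- Let D be an H-colored digraph and k ≥ 2 an integer. If u, v are vertices of D and there exists a closed walk W in D with length at most k such that both u and v lie on W, then (u,v) is a symmetric arc of the (k−1,H)-closure C_H^{k−1}(D), i.e., both (u,v) and (v,u) are arcs of C_H^{k−1}(D). -/
/-!
Setting: `A : V → V → Prop` is the arc relation of a loopless digraph `D`,
`AH : VH → VH → Prop` is the arc relation of a digraph `H` (possibly with loops),
and `ρ : V → V → VH` colors each arc of `D` with a vertex of `H`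
(`D` is an `H`-colored digraph).
-/

open scoped Classical

noncomputable section

variable {V VH : Type*}

/-- `x 0, x 1, …, x n` is a walk of length `n` in the digraph with arc relation `A`. -/
def IsWalk (A : V → V → Prop) (n : ℕ) (x : ℕ → V) : Prop :=
  ∀ i < n, A (x i) (x (i + 1))

/-- A (directed) path of length `n`: a walk whose `n + 1` vertices are pairwise distinct. -/
def IsPath (A : V → V → Prop) (n : ℕ) (x : ℕ → V) : Prop :=
  IsWalk A n x ∧ ∀ i ≤ n, ∀ j ≤ n, x i = x j → i = j

/-- A (directed) cycle of length `n`: a nontrivial closed walk whose first `n` vertices are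
pairwise distinct. -/
def IsCycle (A : V → V → Prop) (n : ℕ) (x : ℕ → V) : Prop :=
  IsWalk A n x ∧ x n = x 0 ∧ 1 ≤ n ∧ ∀ i < n, ∀ j < n, x i = x j → i = j

/-- The set `O_H(W)` of obstructions of an open walk `W = (x 0, …, x n)`: the indices
`i ∈ {1, …, n-1}` such that `(ρ(x_{i-1}, x_i), ρ(x_i, x_{i+1}))` is not an arc of `H`. -/
def obstrOpen (AH : VH → VH → Prop) (ρ : V → V → VH) (n : ℕ) (x : ℕ → V) : Finset ℕ :=
  (Finset.Ico 1 n).filter fun i => ¬ AH (ρ (x (i - 1)) (x i)) (ρ (x i) (x (i + 1)))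

/-- The set `O_H(W)` of obstructions of a closed walk `W = (x 0, …, x n)` (`x n = x 0`):
the indices `i ∈ {0, …, n-1}`, taken modulo `n`, such that
`(ρ(x_{i-1}, x_i), ρ(x_i, x_{i+1}))` is not an arc of `H`. -/
def obstrClosed (AH : VH → VH → Prop) (ρ : V → V → VH) (n : ℕ) (x : ℕ → V) : Finset ℕ :=
  (Finset.range n).filter fun i =>
    ¬ AH (ρ (x (if i = 0 then n - 1 else i - 1)) (x i)) (ρ (x i) (x (i + 1)))

/-- The `H`-length of an open walk: `|O_H(W)| + 1`. -/
def HLenOpen (AH : VH → VH → Prop) (ρ : V → V → VH) (n : ℕ) (x : ℕ → V) : ℕ :=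
  (obstrOpen AH ρ n x).card + 1

/-- The `H`-length of a closed walk: `|O_H(W)|`. -/
def HLenClosed (AH : VH → VH → Prop) (ρ : V → V → VH) (n : ℕ) (x : ℕ → V) : ℕ :=
  (obstrClosed AH ρ n x).card

/-- `(u,v)` is an arc of the `(l,H)`-closure `C_H^l(D)` iff there exists a `uv`-path in `D`
with `H`-length at most `l`. -/
def ClosureAdj (A : V → V → Prop) (AH : VH → VH → Prop) (ρ : V → V → VH) (l : ℕ)
    (u v : V) : Prop :=
  ∃ n x, 1 ≤ n ∧ IsPath A n x ∧ x 0 = u ∧ x n = v ∧ HLenOpen AH ρ n x ≤ l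

/-- `S` is `(k,H)`-independent: every path between two different vertices of `S`
has `H`-length at least `k`. -/
def KHIndependent (A : V → V → Prop) (AH : VH → VH → Prop) (ρ : V → V → VH)
    (k : ℕ) (S : Set V) : Prop :=
  ∀ u ∈ S, ∀ v ∈ S, u ≠ v →
    ∀ n x, IsPath A n x → x 0 = u → x n = v → k ≤ HLenOpen AH ρ n x

/-- `S` is `(l,H)`-absorbent: from every vertex outside `S` there exists a path to some
vertex of `S` with `H`-length at most `l`. -/
def LHAbsorbent (A : V → V → Prop) (AH : VH → VH → Prop) (ρ : V → V → VH)
    (l : ℕ) (S : Set V) : Prop :=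
  ∀ v ∉ S, ∃ w ∈ S, ∃ n x, IsPath A n x ∧ x 0 = v ∧ x n = w ∧ HLenOpen AH ρ n x ≤ l

/-- A `(k,H)`-kernel: a `(k,H)`-independent and `(k-1,H)`-absorbent set of vertices. -/
def IsKHKernel (A : V → V → Prop) (AH : VH → VH → Prop) (ρ : V → V → VH)
    (k : ℕ) (S : Set V) : Prop :=
  KHIndependent A AH ρ k S ∧ LHAbsorbent A AH ρ (k - 1) S

/-- A kernel of a digraph: an independent and absorbent set of vertices. -/
def IsKernel (A : V → V → Prop) (S : Set V) : Prop :=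
  (∀ u ∈ S, ∀ v ∈ S, u ≠ v → ¬ A u v) ∧ ∀ u ∉ S, ∃ v ∈ S, A u v

theorem IsWalk.exists_isPath {A : V → V → Prop} {m : ℕ} {x : ℕ → V} (hx : IsWalk A m x) :
    ∃ p ≤ m, ∃ y, IsPath A p y ∧ y 0 = x 0 ∧ y p = x m := by
  induction m using Nat.strong_induction_on generalizing x with
  | _ m ih =>
    by_cases h : ∃ i j, i < j ∧ j ≤ m ∧ x i = x j
    · obtain ⟨i, j, hij, hjm, hxij⟩ := h
      have hw : IsWalk A (m - (j - i)) fun t => if t ≤ i then x t else x (t + (j - i)) := by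
        intro t ht
        rcases lt_trichotomy t i with h | rfl | h
        · simpa [h.le, Nat.succ_le_of_lt h] using hx t (by omega)
        · have := hx j (by omega)
          have e : t + 1 + (j - t) = j + 1 := by omega
          simpa [e, hxij] using this
        · have := hx (t + (j - i)) (by omega)
          have e : t + 1 + (j - i) = t + (j - i) + 1 := by omega
          simpa [h.not_ge, show ¬ t + 1 ≤ i by omega, e] using this
      obtain ⟨p, hp, y, hy, hy0, hyp⟩ := ih (m - (j - i)) (by omega) hw
      refine ⟨p, by omega, y, hy, by simpa using hy0, hyp.trans ?_⟩
      split_ifs with hle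
      · rw [show m - (j - i) = i by omega, hxij, show j = m by omega]
      · rw [show m - (j - i) + (j - i) = m by omega]
    · push Not at h
      refine ⟨m, le_rfl, x, ⟨hx, fun i hi j hj hij => ?_⟩, rfl, rfl⟩
      rcases lt_trichotomy i j with hlt | heq | hlt
      · exact absurd hij (h i j hlt hj)
      · exact heq
      · exact absurd hij.symm (h j i hlt hi)

theorem HLenOpen_le (AH : VH → VH → Prop) (ρ : V → V → VH) {n : ℕ} (hn : 1 ≤ n) (x : ℕ → V) :
    HLenOpen AH ρ n x ≤ n := by
  have h : (obstrOpen AH ρ n x).card ≤ (Finset.Ico 1 n).card :=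
    Finset.card_filter_le _ _
  rw [Nat.card_Ico] at h
  unfold HLenOpen
  omega

theorem IsWalk.closureAdj {A : V → V → Prop} (AH : VH → VH → Prop) (ρ : V → V → VH)
    {l m : ℕ} {x : ℕ → V} (hx : IsWalk A m x) (hml : m ≤ l) (hne : x 0 ≠ x m) :
    ClosureAdj A AH ρ l (x 0) (x m) := by
  obtain ⟨p, hp, y, hy, hy0, hyp⟩ := hx.exists_isPath
  have hp1 : 1 ≤ p := by
    rw [Nat.one_le_iff_ne_zero]
    rintro rfl
    exact hne (hy0.symm.trans hyp)
  exact ⟨p, y, hp1, hy, hy0, hyp, (HLenOpen_le AH ρ hp1 y).trans (hp.trans hml)⟩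

/-- Two distinct vertices of a closed walk of length `n` are joined, in the given order,
by a subwalk of length less than `n`. -/
theorem IsWalk.exists_subwalk_of_closed {A : V → V → Prop} {n : ℕ} {x : ℕ → V}
    (hW : IsWalk A n x) (hclosed : x n = x 0) {i j : ℕ} (hi : i ≤ n) (hj : j ≤ n)
    (hne : x i ≠ x j) : ∃ m < n, ∃ y, IsWalk A m y ∧ y 0 = x i ∧ y m = x j := by
  rcases lt_trichotomy i j with h | rfl | h
  · have hlt : j - i < n := by
      by_contra hge
      obtain rfl : i = 0 := by omega
      obtain rfl : j = n := by omega
      exact hne hclosed.symm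
    refine ⟨j - i, hlt, fun t => x (i + t), fun t ht => hW (i + t) (by omega), rfl, ?_⟩
    simp [h.le]
  · exact absurd rfl hne
  · refine ⟨n - i + j, by omega, fun t => if i + t ≤ n then x (i + t) else x (i + t - n),
      fun t ht => ?_, by simp [hi], ?_⟩
    · rcases lt_trichotomy (i + t) n with h' | h' | h'
      · simpa [h'.le, ← add_assoc, show i + t + 1 ≤ n by omega] using hW (i + t) h'
      · have := hW 0 (by omega)
        simpa [h', show ¬ i + (t + 1) ≤ n by omega, show i + (t + 1) - n = 1 by omega,
          hclosed] using this
      · have := hW (i + t - n) (by omega)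
        simpa [h'.not_ge, show ¬ i + (t + 1) ≤ n by omega,
          show i + (t + 1) - n = i + t - n + 1 by omega] using this
    · have e : i + (n - i + j) = n + j := by omega
      rcases Nat.eq_zero_or_pos j with rfl | hj0
      · simp [Nat.add_sub_cancel' hi, hclosed]
      · simp [e, hj0.ne']

/-- If there exists a closed walk in `D` of length at most `k` containing both `u` and `v`,
then `(u,v)` is a symmetric arc of the `(k-1,H)`-closure of `D`. -/
theorem symm_closureAdj_of_closed_walk
    (A : V → V → Prop) (hloopless : ∀ v : V, ¬ A v v)
    (AH : VH → VH → Prop) (ρ : V → V → VH)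
    (k : ℕ) (hk : 2 ≤ k)
    (u v : V) (huv : u ≠ v)
    (n : ℕ) (x : ℕ → V) (hW : IsWalk A n x) (hclosed : x n = x 0) (hn : n ≤ k)
    (hu : ∃ i ≤ n, x i = u) (hv : ∃ j ≤ n, x j = v) :
    ClosureAdj A AH ρ (k - 1) u v ∧ ClosureAdj A AH ρ (k - 1) v u := by
  obtain ⟨i, hi, rfl⟩ := hu
  obtain ⟨j, hj, rfl⟩ := hv
  have joined : ∀ i ≤ n, ∀ j ≤ n, x i ≠ x j → ClosureAdj A AH ρ (k - 1) (x i) (x j) := by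
    intro i hi j hj hne
    obtain ⟨m, hm, y, hy, hy0, hym⟩ := hW.exists_subwalk_of_closed hclosed hi hj hne
    rw [← hy0, ← hym] at hne ⊢
    exact hy.closureAdj AH ρ (by omega) hne
  exact ⟨joined i hi j hj huv, joined j hj i hi huv.symm⟩
end
end

section
/- Let D be an H-colored semicomplete digraph. If k ≥ 3, then D has a (k,H)-kernel. -/
/-!
Setting: `A : V → V → Prop` is the arc relation of a loopless digraph `D`,
`AH : VH → VH → Prop` is the arc relation of a digraph `H` (possibly with loops),
and `ρ : V → V → VH` colors each arc of `D` with a vertex of `H`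
(`D` is an `H`-colored digraph).
-/

open scoped Classical

noncomputable section

variable {V VH : Type*}

/-- A digraph is semicomplete if every two different vertices are joined by at least one arc. -/
def Semicomplete (A : V → V → Prop) : Prop :=
  ∀ u v : V, u ≠ v → A u v ∨ A v u

/-- A nonempty finite semicomplete digraph has a vertex that is reached from every other vertex
by a path of length one or two. -/
theorem Semicomplete.exists_forall_adj_or_adj_adj [Finite V] [Nonempty V]
    {A : V → V → Prop} (hloopless : ∀ v : V, ¬ A v v) (hsemi : Semicomplete A) :
    ∃ v, ∀ u, u ≠ v → A u v ∨ ∃ w, A u w ∧ A w v := by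
  obtain ⟨v, hv⟩ := Finite.exists_max fun v => {w | A w v}.ncard
  refine ⟨v, fun u huv => ?_⟩
  by_contra! ⟨hnot, hmid⟩
  refine (hv u).not_gt (Set.ncard_lt_ncard (Set.ssubset_iff_exists.2 ⟨?_, v, ?_, hloopless v⟩))
  · intro w (hw : A w v)
    have hne : u ≠ w := by rintro rfl; exact hnot hw
    exact (hsemi u w hne).resolve_left fun h => hmid w h hw
  · exact (hsemi u v huv).resolve_left hnot

/-- Every `H`-colored semicomplete digraph has a `(k,H)`-kernel for every `k ≥ 3`. -/
theorem semicomplete_has_kHKernel [Fintype V]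
    (A : V → V → Prop) (hloopless : ∀ v : V, ¬ A v v)
    (hsemi : Semicomplete A)
    (AH : VH → VH → Prop) (ρ : V → V → VH)
    (k : ℕ) (hk : 3 ≤ k) :
    ∃ S : Set V, IsKHKernel A AH ρ k S := by
  rcases isEmpty_or_nonempty V with hV | hV
  · exact ⟨∅, fun u => isEmptyElim u, fun v => isEmptyElim v⟩
  obtain ⟨v, hv⟩ := hsemi.exists_forall_adj_or_adj_adj hloopless
  refine ⟨{v}, ?_, ?_⟩
  · rintro a rfl b rfl hab
    exact absurd rfl hab
  · intro u (hu : u ≠ v)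
    refine ⟨v, rfl, ?_⟩
    by_cases huv : A u v
    · refine ⟨1, fun i => if i = 0 then u else v, ⟨?_, ?_⟩, rfl, rfl,
        (HLenOpen_le AH ρ le_rfl _).trans (by omega)⟩
      · intro i hi
        interval_cases i
        simpa using huv
      · intro i hi j hj
        interval_cases i <;> interval_cases j <;> simp [hu, hu.symm]
    · obtain ⟨w, huw, hwv⟩ := (hv u hu).resolve_left huv
      have hne : u ≠ w := by rintro rfl; exact hloopless u huw
      have hne' : w ≠ v := by rintro rfl; exact hloopless w hwv
      refine ⟨2, fun i => if i = 0 then u else if i = 1 then w else v, ⟨?_, ?_⟩, rfl, rfl,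
        (HLenOpen_le AH ρ one_le_two _).trans (by omega)⟩
      · intro i hi
        interval_cases i
        · simpa using huw
        · simpa using hwv
      · intro i hi j hj
        interval_cases i <;> interval_cases j <;>
          simp [hu, hu.symm, hne, hne.symm, hne', hne'.symm]
end
end

section
/- If D is an H-colored tournament and every 3-cycle in D is an H-cycle, then for every k ≥ 2, D has a (k,H)-kernel. -/
/-!
Setting: `A : V → V → Prop` is the arc relation of a loopless digraph `D`,
`AH : VH → VH → Prop` is the arc relation of a digraph `H` (possibly with loops),
and `ρ : V → V → VH` colors each arc of `D` with a vertex of `H`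
(`D` is an `H`-colored digraph).
-/

open scoped Classical

noncomputable section

variable {V VH : Type*}

/-- A tournament: every two different vertices are joined by exactly one arc. -/
def IsTournamentRel (A : V → V → Prop) : Prop :=
  ∀ u v : V, u ≠ v → (A u v ↔ ¬ A v u)

/-- A vertex of maximum in-degree in a finite tournament is reached from every other vertex by a
path of length at most two. -/
theorem exists_forall_adj_or_exists_adj_adj [Fintype V] [Nonempty V] {A : V → V → Prop}
    (hloopless : ∀ v : V, ¬ A v v) (htour : IsTournamentRel A) :
    ∃ w, ∀ v ≠ w, A v w ∨ ∃ u, A v u ∧ A u w ∧ A w v := by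
  obtain ⟨w, hw⟩ := Finite.exists_max fun w : V => (Finset.univ.filter (A · w)).card
  refine ⟨w, fun v hvw => or_iff_not_imp_left.2 fun hv => ?_⟩
  have hwv : A w v := (htour w v hvw.symm).2 hv
  by_contra! h
  refine (hw v).not_gt (Finset.card_lt_card (Finset.ssubset_iff.2 ⟨w, by simp [hloopless], ?_⟩))
  intro u hu
  rw [Finset.mem_insert, Finset.mem_filter] at hu
  rw [Finset.mem_filter]
  refine ⟨Finset.mem_univ u, ?_⟩
  rcases hu with rfl | ⟨-, huw⟩
  · exact hwv
  · have huv : u ≠ v := fun huv => hv (huv ▸ huw)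
    exact (htour u v huv).2 fun hvu => h u hvu huw hwv

/-- An arc is a path of `H`-length `1`. -/
theorem exists_isPath_HLenOpen_of_adj {A : V → V → Prop} (hloopless : ∀ v : V, ¬ A v v)
    (AH : VH → VH → Prop) (ρ : V → V → VH) {v w : V} (h : A v w) :
    ∃ n x, IsPath A n x ∧ x 0 = v ∧ x n = w ∧ HLenOpen AH ρ n x = 1 := by
  have hvw : v ≠ w := fun hvw => hloopless w (hvw ▸ h)
  refine ⟨1, fun i => if i = 0 then v else w, ⟨fun i hi => ?_, fun i hi j hj hij => ?_⟩,
    by simp, by simp, by simp [HLenOpen, obstrOpen]⟩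
  · obtain rfl : i = 0 := by omega
    simpa using h
  · interval_cases i <;> interval_cases j <;> simp_all

/-- Two consecutive arcs of a `3`-cycle that is an `H`-cycle form a path of `H`-length `1`. -/
theorem exists_isPath_HLenOpen_of_triangle {A : V → V → Prop} (hloopless : ∀ v : V, ¬ A v v)
    (AH : VH → VH → Prop) (ρ : V → V → VH)
    (hHcyc : ∀ x : ℕ → V, IsCycle A 3 x → obstrClosed AH ρ 3 x = ∅)
    {v u w : V} (hvu : A v u) (huw : A u w) (hwv : A w v) :
    ∃ n x, IsPath A n x ∧ x 0 = v ∧ x n = w ∧ HLenOpen AH ρ n x = 1 := by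
  have hne : ∀ {a b : V}, A a b → a ≠ b := fun h hab => hloopless _ (hab ▸ h)
  have h₁ := hne hvu
  have h₂ := hne huw
  have h₃ := hne hwv
  let x : ℕ → V := fun i => if i % 3 = 0 then v else if i % 3 = 1 then u else w
  have hinj : ∀ i < 3, ∀ j < 3, x i = x j → i = j := by
    intro i hi j hj hij
    interval_cases i <;> interval_cases j <;> simp_all [x, eq_comm]
  have hwalk : IsWalk A 3 x := by
    intro i hi
    interval_cases i <;> simpa [x]
  have hobs := hHcyc x ⟨hwalk, by simp [x], by norm_num, hinj⟩
  have hAH : AH (ρ v u) (ρ u w) := by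
    by_contra hn
    have hmem : 1 ∈ obstrClosed AH ρ 3 x := by simpa [obstrClosed, x] using hn
    simp [hobs] at hmem
  refine ⟨2, x, ⟨fun i hi => hwalk i (by omega),
    fun i hi j hj => hinj i (by omega) j (by omega)⟩, by simp [x], by simp [x], ?_⟩
  have hempty : obstrOpen AH ρ 2 x = ∅ := by
    refine Finset.filter_eq_empty_iff.2 fun i hi => ?_
    obtain rfl : i = 1 := by
      rw [Finset.mem_Ico] at hi
      omega
    simpa [x] using hAH
  simp [HLenOpen, hempty]

/-- Every `H`-colored tournament in which every `3`-cycle is an `H`-cycle has a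
`(k,H)`-kernel for every `k ≥ 2`. -/
theorem tournament_has_kHKernel_of_H_triangles [Fintype V]
    (A : V → V → Prop) (hloopless : ∀ v : V, ¬ A v v)
    (htour : IsTournamentRel A)
    (AH : VH → VH → Prop) (ρ : V → V → VH)
    (hHcyc : ∀ x : ℕ → V, IsCycle A 3 x → obstrClosed AH ρ 3 x = ∅)
    (k : ℕ) (hk : 2 ≤ k) :
    ∃ S : Set V, IsKHKernel A AH ρ k S := by
  rcases isEmpty_or_nonempty V with _ | _
  · exact ⟨∅, fun u => isEmptyElim u, fun v => isEmptyElim v⟩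
  obtain ⟨w, hw⟩ := exists_forall_adj_or_exists_adj_adj hloopless htour
  refine ⟨{w}, fun u hu v hv huv => absurd (hu.trans hv.symm) huv, fun v hv => ?_⟩
  have hpath : ∃ n x, IsPath A n x ∧ x 0 = v ∧ x n = w ∧ HLenOpen AH ρ n x = 1 := by
    rcases hw v hv with h | ⟨u, hvu, huw, hwv⟩
    · exact exists_isPath_HLenOpen_of_adj hloopless AH ρ h
    · exact exists_isPath_HLenOpen_of_triangle hloopless AH ρ hHcyc hvu huw hwv
  obtain ⟨n, x, hx, h0, hn, hlen⟩ := hpath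
  exact ⟨w, rfl, n, x, hx, h0, hn, by omega⟩
end
end

section
/- Let D be an H-colored r-transitive digraph (r ≥ 2). For every k ≥ r, D has a (k,H)-kernel. -/
/-!
Setting: `A : V → V → Prop` is the arc relation of a loopless digraph `D`,
`AH : VH → VH → Prop` is the arc relation of a digraph `H` (possibly with loops),
and `ρ : V → V → VH` colors each arc of `D` with a vertex of `H`
(`D` is an `H`-colored digraph).
-/

open scoped Classical

noncomputable section

variable {V VH : Type*}

/-- A digraph is `r`-transitive if the existence of a `uv`-path of length `r` implies
that `(u,v)` is an arc. -/
def RTransitive (A : V → V → Prop) (r : ℕ) : Prop :=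
  ∀ x : ℕ → V, IsPath A r x → A (x 0) (x r)

/-- Vertices joined by a walk are related by the reflexive transitive closure of the arc
relation. -/
theorem IsWalk.reflTransGen {A : V → V → Prop} {n : ℕ} {x : ℕ → V} (h : IsWalk A n x) :
    Relation.ReflTransGen A (x 0) (x n) := by
  induction n with
  | zero => exact .refl
  | succ n ih =>
    exact (ih fun i hi => h i (Nat.lt_succ_of_lt hi)).tail (h n (Nat.lt_succ_self n))

/-- Vertices related by the reflexive transitive closure of the arc relation are joined by a
walk. -/
theorem exists_isWalk_of_reflTransGen {A : V → V → Prop} {u v : V}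
    (h : Relation.ReflTransGen A u v) : ∃ n x, IsWalk A n x ∧ x 0 = u ∧ x n = v := by
  induction h using Relation.ReflTransGen.head_induction_on with
  | refl => exact ⟨0, fun _ => v, fun i hi => absurd hi (Nat.not_lt_zero i), rfl, rfl⟩
  | @head a _ hab _ ih =>
    obtain ⟨n, x, hx, h0, hn⟩ := ih
    refine ⟨n + 1, fun t => Nat.casesOn t a x, fun i hi => ?_, rfl, hn⟩
    cases i with
    | zero => simpa [h0] using hab
    | succ i => exact hx i (by omega)

/-- Removing the vertices strictly between the `i`-th and the `j`-th from a walk gives a walk,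
provided that the `i`-th vertex is joined by an arc to the vertex with index `j`. -/
theorem IsWalk.shortcut {A : V → V → Prop} {n : ℕ} {x : ℕ → V} (h : IsWalk A n x) {i j : ℕ}
    (hij : i < j) (hjn : j ≤ n) (harc : A (x i) (x j)) :
    ∃ y, IsWalk A (n - (j - i - 1)) y ∧ y 0 = x 0 ∧ y (n - (j - i - 1)) = x n := by
  refine ⟨fun t => if t ≤ i then x t else x (t + (j - i - 1)), fun t ht => ?_, by simp, ?_⟩
  · rcases lt_trichotomy t i with hti | rfl | hti
    · simpa [hti.le, Nat.succ_le_of_lt hti] using h t (by omega)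
    · have e : t + 1 + (j - t - 1) = j := by omega
      simpa [e] using harc
    · have e : t + 1 + (j - i - 1) = t + (j - i - 1) + 1 := by omega
      simpa [hti.not_ge, (hti.trans (Nat.lt_succ_self t)).not_ge, e] using
        h (t + (j - i - 1)) (by omega)
  · have e : n - (j - i - 1) + (j - i - 1) = n := by omega
    have hi : ¬ n - (j - i - 1) ≤ i := by omega
    simp [hi, e]

/-- A shortest walk between two vertices is a path. -/
theorem IsWalk.isPath_of_minimal {A : V → V → Prop} {n : ℕ} {x : ℕ → V} (h : IsWalk A n x)
    (hmin : ∀ m y, IsWalk A m y → y 0 = x 0 → y m = x n → n ≤ m) : IsPath A n x := by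
  have key : ∀ i j, i < j → j ≤ n → x i ≠ x j := by
    intro i j hij hjn he
    rcases hjn.eq_or_lt with rfl | hjn
    · have := hmin i x (fun t ht => h t (by omega)) rfl he
      omega
    · obtain ⟨y, hy, h0, hn⟩ := h.shortcut (i := i) (j := j + 1) (by omega) hjn
        (he ▸ h j hjn)
      have := hmin _ y hy h0 hn
      omega
  refine ⟨h, fun i hi j hj he => ?_⟩
  rcases lt_trichotomy i j with hij | hij | hij
  · exact absurd he (key i j hij hj)
  · exact hij
  · exact absurd he.symm (key j i hij hi)

/-- In an `r`-transitive digraph, reachability is witnessed by paths of length less than `r`. -/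
theorem RTransitive.exists_isPath_lt {A : V → V → Prop} {r : ℕ} (htr : RTransitive A r)
    (hr : 2 ≤ r) {u v : V} (h : Relation.ReflTransGen A u v) :
    ∃ n < r, ∃ x, IsPath A n x ∧ x 0 = u ∧ x n = v := by
  have hex := exists_isWalk_of_reflTransGen h
  obtain ⟨x, hx, hu, hv⟩ := Nat.find_spec hex
  have hmin : ∀ m y, IsWalk A m y → y 0 = x 0 → y m = x (Nat.find hex) → Nat.find hex ≤ m :=
    fun m y hy h0 hm => Nat.find_min' hex ⟨y, hy, h0.trans hu, hm.trans hv⟩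
  have hp := hx.isPath_of_minimal hmin
  refine ⟨_, ?_, x, hp, hu, hv⟩
  by_contra! hle
  obtain ⟨y, hy, h0, hm⟩ := hx.shortcut (i := 0) (by omega) hle
    (htr x ⟨fun i hi => hx i (by omega),
      fun i hi j hj => hp.2 i (by omega) j (by omega)⟩)
  have := hmin _ y hy h0 hm
  omega

/-- A finite preorder has a set of pairwise incomparable elements above all elements. -/
theorem exists_isAntichain_forall_exists_le (α : Type*) [Preorder α] [Finite α] :
    ∃ S : Set α, IsAntichain (· ≤ ·) S ∧ ∀ a, ∃ b ∈ S, a ≤ b := by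
  refine ⟨{m | IsMax m ∧ ofAntisymmetrization (· ≤ ·) (toAntisymmetrization (· ≤ ·) m) = m},
    ?_, fun a => ?_⟩
  · rintro u ⟨hu, hu'⟩ v ⟨-, hv'⟩ hne hle
    have e : toAntisymmetrization (· ≤ ·) u = toAntisymmetrization (· ≤ ·) v :=
      Quotient.sound ⟨hle, hu hle⟩
    exact hne (by rw [← hu', ← hv', e])
  · obtain ⟨m, ham, hm⟩ := Set.finite_univ.exists_le_maximal (Set.mem_univ a)
    have hmax : IsMax m := fun b hb => hm.2 (Set.mem_univ b) hb
    have heq : AntisymmRel (· ≤ ·)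
        (ofAntisymmetrization (· ≤ ·) (toAntisymmetrization (· ≤ ·) m)) m :=
      Quotient.exact (toAntisymmetrization_ofAntisymmetrization _ _)
    exact ⟨_, ⟨fun b hb => (hmax (heq.2.trans hb)).trans heq.2, by
      rw [toAntisymmetrization_ofAntisymmetrization]⟩, ham.trans heq.2⟩

/-- Every `H`-colored `r`-transitive digraph (`r ≥ 2`) has a `(k,H)`-kernel for every
`k ≥ r`. -/
theorem rTransitive_has_kHKernel [Fintype V]
    (A : V → V → Prop) (hloopless : ∀ v : V, ¬ A v v)
    (r : ℕ) (hr : 2 ≤ r) (htr : RTransitive A r)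
    (AH : VH → VH → Prop) (ρ : V → V → VH)
    (k : ℕ) (hk : r ≤ k) :
    ∃ S : Set V, IsKHKernel A AH ρ k S := by
  let _ : Preorder V :=
    { le := Relation.ReflTransGen A
      le_refl := fun _ => .refl
      le_trans := fun _ _ _ => .trans }
  obtain ⟨S, hS, habs⟩ := exists_isAntichain_forall_exists_le V
  refine ⟨S, fun u hu v hv huv n x hx h0 hn => ?_, fun v hv => ?_⟩
  · subst h0 hn
    exact absurd hx.1.reflTransGen (hS hu hv huv)
  · obtain ⟨w, hw, hvw⟩ := habs v
    obtain ⟨n, hnr, x, hx, h0, hn⟩ := htr.exists_isPath_lt hr hvw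
    have hn1 : 1 ≤ n := by
      rw [Nat.one_le_iff_ne_zero]
      rintro rfl
      exact hv (h0 ▸ hn ▸ hw)
    have := HLenOpen_le AH ρ hn1 x
    exact ⟨w, hw, n, x, hx, h0, hn, by omega⟩
end
end

section
/- Let D be an H-colored transitive digraph. If k ≥ 2, then D has a (k,H)-kernel. -/
/-!
Setting: `A : V → V → Prop` is the arc relation of a loopless digraph `D`,
`AH : VH → VH → Prop` is the arc relation of a digraph `H` (possibly with loops),
and `ρ : V → V → VH` colors each arc of `D` with a vertex of `H`
(`D` is an `H`-colored digraph).
-/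

open scoped Classical

noncomputable section

variable {V VH : Type*}

theorem RTransitive.adj_of_adj {A : V → V → Prop} (hloopless : ∀ v, ¬ A v v)
    (htr : RTransitive A 2) {u v w : V} (huv : A u v) (hvw : A v w) (huw : u ≠ w) : A u w := by
  have h₁ : u ≠ v := fun h => hloopless v (h ▸ huv)
  have h₂ : v ≠ w := fun h => hloopless w (h ▸ hvw)
  refine htr (fun i => if i = 0 then u else if i = 1 then v else w) ⟨fun i hi => ?_, ?_⟩
  · interval_cases i <;> simpa
  · intro i hi j hj
    interval_cases i <;> interval_cases j <;> simp_all [eq_comm]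

/-- The preorder of reachability in a loopless transitive digraph. -/
@[reducible]
def reachPreorder (A : V → V → Prop) (hloopless : ∀ v, ¬ A v v)
    (htr : RTransitive A 2) : Preorder V where
  le u v := u = v ∨ A u v
  le_refl _ := Or.inl rfl
  le_trans u v w huv hvw := by
    rcases huv with rfl | huv
    · exact hvw
    rcases hvw with rfl | hvw
    · exact Or.inr huv
    · exact or_iff_not_imp_left.2 (htr.adj_of_adj hloopless huv hvw)

theorem IsWalk.eq_or_adj {A : V → V → Prop} (hloopless : ∀ v, ¬ A v v)
    (htr : RTransitive A 2) {n : ℕ} {x : ℕ → V} (hx : IsWalk A n x) :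
    x 0 = x n ∨ A (x 0) (x n) := by
  let := reachPreorder A hloopless htr
  induction n with
  | zero => exact Or.inl rfl
  | succ n ih =>
    have h₁ : x 0 ≤ x n := ih fun i hi => hx i (hi.trans n.lt_succ_self)
    have h₂ : x n ≤ x (n + 1) := Or.inr (hx n n.lt_succ_self)
    exact h₁.trans h₂

/-- On a finite preorder, choosing one representative of every maximal class gives a set of
pairwise incomparable elements above every element. -/
theorem exists_antichain_forall_exists_le (V : Type*) [Preorder V] [Finite V] :
    ∃ S : Set V, IsAntichain (· ≤ ·) S ∧ ∀ v, ∃ w ∈ S, v ≤ w := by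
  let rep : V → V := fun v => ofAntisymmetrization (· ≤ ·) (toAntisymmetrization (· ≤ ·) v)
  have hrep : ∀ v, AntisymmRel (· ≤ ·) (rep v) v := fun v =>
    Quotient.exact (toAntisymmetrization_ofAntisymmetrization (· ≤ ·) _)
  have hcongr : ∀ {u v}, AntisymmRel (· ≤ ·) u v → rep u = rep v := fun h =>
    congrArg (ofAntisymmetrization (· ≤ ·)) (Quotient.sound h)
  refine ⟨{v | IsMax v ∧ rep v = v}, fun u hu v hv hne huv => hne ?_, fun v => ?_⟩
  · rw [← hu.2, ← hv.2]
    exact hcongr ⟨huv, hu.1 huv⟩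
  · obtain ⟨w, hvw, hw⟩ := Finite.exists_le_maximal (p := fun _ : V => True) (a := v) trivial
    have hmax : IsMax w := fun b hb => hw.2 trivial hb
    exact ⟨rep w, ⟨fun b hb => (hmax ((hrep w).2.trans hb)).trans (hrep w).2, hcongr (hrep w)⟩,
      hvw.trans (hrep w).2⟩

theorem isPath_arc {A : V → V → Prop} {u v : V} (huv : A u v) (hne : u ≠ v) :
    IsPath A 1 (fun i => if i = 0 then u else v) := by
  refine ⟨fun i hi => ?_, fun i hi j hj => ?_⟩
  · interval_cases i
    simpa
  · interval_cases i <;> interval_cases j <;> simp [hne, hne.symm]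

theorem HLenOpen_one (AH : VH → VH → Prop) (ρ : V → V → VH) (x : ℕ → V) :
    HLenOpen AH ρ 1 x = 1 := by
  simp [HLenOpen, obstrOpen]

/-- Every `H`-colored transitive digraph has a `(k,H)`-kernel for every `k ≥ 2`. -/
theorem transitive_has_kHKernel [Fintype V]
    (A : V → V → Prop) (hloopless : ∀ v : V, ¬ A v v)
    (htr : RTransitive A 2)
    (AH : VH → VH → Prop) (ρ : V → V → VH)
    (k : ℕ) (hk : 2 ≤ k) :
    ∃ S : Set V, IsKHKernel A AH ρ k S := by
  let := reachPreorder A hloopless htr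
  obtain ⟨S, hanti, habs⟩ := exists_antichain_forall_exists_le V
  refine ⟨S, fun u hu v hv hne n x hx h0 hn => ?_, fun v hv => ?_⟩
  · subst h0 hn
    exact absurd (hx.1.eq_or_adj hloopless htr) (hanti hu hv hne)
  · obtain ⟨w, hw, hvw⟩ := habs v
    have hne : v ≠ w := fun h => hv (h ▸ hw)
    refine ⟨w, hw, 1, _, isPath_arc (Or.resolve_left hvw hne) hne, rfl, rfl, ?_⟩
    rw [HLenOpen_one]
    omega
end
end

section
/- Let D be an H-colored r-quasi-transitive digraph (r ≥ 2) such that every cycle in D with length r+1 is an H-cycle, and let u, v be vertices of D. If d_D(u,v) ≥ r and T is a uv-geodesic in D (a uv-path of minimum length), then T is an H-path. -/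
/-!
Setting: `A : V → V → Prop` is the arc relation of a loopless digraph `D`,
`AH : VH → VH → Prop` is the arc relation of a digraph `H` (possibly with loops),
and `ρ : V → V → VH` colors each arc of `D` with a vertex of `H`
(`D` is an `H`-colored digraph).
-/

open scoped Classical

noncomputable section

variable {V VH : Type*}

/-- A digraph is `r`-quasi-transitive if the endpoints of every path of length `r` are
joined by an arc. -/
def RQuasiTransitive (A : V → V → Prop) (r : ℕ) : Prop :=
  ∀ x : ℕ → V, IsPath A r x → A (x 0) (x r) ∨ A (x r) (x 0)

/-- A segment of a path is a path. -/
theorem IsPath.segment {A : V → V → Prop} {n s m : ℕ} {x : ℕ → V} (hx : IsPath A n x)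
    (hsm : s + m ≤ n) : IsPath A m fun j => x (s + j) := by
  refine ⟨fun i hi => hx.1 (s + i) (by omega), fun i hi j hj hij => ?_⟩
  have := hx.2 (s + i) (by omega) (s + j) (by omega) hij
  omega

/-- Replacing the segment of length `m` of a path that starts at position `s` by a single arc
gives a path. -/
theorem IsPath.shortcut {A : V → V → Prop} {n s m : ℕ} {x : ℕ → V} (hx : IsPath A n x)
    (hm : 1 ≤ m) (hsm : s + m ≤ n) (harc : A (x s) (x (s + m))) :
    IsPath A (n - m + 1) fun j => x (if j ≤ s then j else j + (m - 1)) := by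
  refine ⟨fun i hi => ?_, fun i hi j hj hij => ?_⟩
  · rcases lt_trichotomy i s with h | rfl | h
    · simpa [h.le, Nat.succ_le_of_lt h] using hx.1 i (by omega)
    · have : i + 1 + (m - 1) = i + m := by omega
      simpa [this] using harc
    · have hi' : ¬ i + 1 ≤ s := by omega
      have : i + 1 + (m - 1) = i + (m - 1) + 1 := by omega
      simpa only [if_neg h.not_ge, if_neg hi', this] using hx.1 (i + (m - 1)) (by omega)
  · have := hx.2 _ (by split_ifs <;> omega) _ (by split_ifs <;> omega) hij
    split_ifs at this <;> omega

/-- A path together with an arc from its last vertex to its first vertex is a cycle. -/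
theorem IsPath.isCycle {A : V → V → Prop} {m : ℕ} {x : ℕ → V} (hx : IsPath A m x)
    (harc : A (x m) (x 0)) : IsCycle A (m + 1) fun j => x (if j ≤ m then j else 0) := by
  refine ⟨fun i hi => ?_, by simp, by omega, fun i hi j hj hij => ?_⟩
  · rcases (Nat.le_of_lt_succ hi).lt_or_eq with h | rfl
    · simpa [h.le, Nat.succ_le_of_lt h] using hx.1 i h
    · simpa using harc
  · have hi_le := Nat.le_of_lt_succ hi
    have hj_le := Nat.le_of_lt_succ hj
    simp only [if_pos hi_le, if_pos hj_le] at hij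
    exact hx.2 i hi_le j hj_le hij

/-- In an `H`-colored `r`-quasi-transitive digraph (`r ≥ 2`) in which every cycle of length
`r + 1` is an `H`-cycle: if `d_D(u,v) ≥ r` and `T` is a `uv`-geodesic, then `T` is an
`H`-path (it has no obstructions). -/
theorem geodesic_isHPath_of_rQuasiTransitive
    (A : V → V → Prop) (hloopless : ∀ v : V, ¬ A v v)
    (r : ℕ) (hr : 2 ≤ r) (hrqt : RQuasiTransitive A r)
    (AH : VH → VH → Prop) (ρ : V → V → VH)
    (hHcyc : ∀ y : ℕ → V, IsCycle A (r + 1) y → obstrClosed AH ρ (r + 1) y = ∅)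
    (u v : V) (n : ℕ) (x : ℕ → V)
    (hT : IsPath A n x) (hx0 : x 0 = u) (hxn : x n = v)
    (hgeo : ∀ m (y : ℕ → V), IsPath A m y → y 0 = u → y m = v → n ≤ m)
    (hd : r ≤ n) :
    obstrOpen AH ρ n x = ∅ := by
  refine Finset.filter_eq_empty_iff.mpr fun i hi => not_not.mpr ?_
  rw [Finset.mem_Ico] at hi
  obtain ⟨s, k, hik, hk, hkr, hsn⟩ : ∃ s k, i = s + k ∧ 1 ≤ k ∧ k < r ∧ s + r ≤ n := by
    rcases le_total (i - 1) (n - r) with h | h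
    · exact ⟨i - 1, 1, by omega, by omega, by omega, by omega⟩
    · exact ⟨n - r, i - (n - r), by omega, by omega, by omega, by omega⟩
  subst hik
  have hseg := hT.segment hsn
  rcases hrqt _ hseg with harc | harc
  · have hend : ¬ n - r + 1 ≤ s := by omega
    have := hgeo _ _ (hT.shortcut (by omega) hsn harc) (by simpa using hx0) (by
      have : n - r + 1 + (r - 1) = n := by omega
      simpa only [if_neg hend, this] using hxn)
    omega
  · have hobs := Finset.filter_eq_empty_iff.mp (hHcyc _ (hseg.isCycle harc))
      (Finset.mem_range.mpr (show k < r + 1 by omega))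
    have hk0 : k ≠ 0 := by omega
    have hk1 : k - 1 ≤ r := by omega
    have hk2 : k + 1 ≤ r := by omega
    simpa only [if_neg hk0, if_pos hk1, if_pos hkr.le, if_pos hk2, not_not,
      ← Nat.add_sub_assoc hk, ← add_assoc] using hobs
end
end
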